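/- arXiv:2303.11495 — 2 statements merged into one kernel-verified Lean document; each statement's English description precedes it below -/
import Mathlib

section
/- Suppose U = 0 and h, u solve the linearized Serre equations on [x_L, x_R] × [0, ∞). Define C = 2√2·H² and the functions w₄ = (1/C)(2H²·∂²u/(∂x∂t) − 6g·h − 2H²·u) and w₅ = (1/C)(2H²·∂²u/(∂x∂t) − 6g·h + 2H²·u). Assume there are real constants α, β with −1 ≤ α ≤ 1 and −1 ≤ β ≤ 1 such that for all t ≥ 0 the boundary conditions w₄(x_L,t) = α·w₅(x_L,t) and w₅(x_R,t) = β·w₄(x_R,t) hold. Then the energy is bounded by the energy of the initial data: E(t) ≤ E(0) for all t ≥ 0. -/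
open Real MeasureTheory Set

noncomputable section

/-- Partial derivative in the spatial variable `x` (first argument). -/
def pdX (f : ℝ → ℝ → ℝ) (x t : ℝ) : ℝ := deriv (fun ξ => f ξ t) x

/-- Partial derivative in the temporal variable `t` (second argument). -/
def pdT (f : ℝ → ℝ → ℝ) (x t : ℝ) : ℝ := deriv (fun τ => f x τ) t

/-- `h, u` solve the linearized Serre equations on `[xL, xR] × [0, ∞)`:
they are sufficiently smooth and satisfy the continuity and momentum equations. -/
def SolvesSerre (g H U xL xR : ℝ) (h u : ℝ → ℝ → ℝ) : Prop :=
  ContDiff ℝ 3 (fun p : ℝ × ℝ => h p.1 p.2) ∧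
  ContDiff ℝ 3 (fun p : ℝ × ℝ => u p.1 p.2) ∧
  (∀ x ∈ Set.Icc xL xR, ∀ t : ℝ, 0 ≤ t →
    pdT h x t + pdX (fun ξ τ => H * u ξ τ + U * h ξ τ) x t = 0) ∧
  (∀ x ∈ Set.Icc xL xR, ∀ t : ℝ, 0 ≤ t →
    pdT u x t + pdX (fun ξ τ => g * h ξ τ + U * u ξ τ
      - H ^ 2 * U / 3 * pdX (pdX u) ξ τ
      - H ^ 2 / 3 * pdT (pdX u) ξ τ) x t = 0)

/-- The energy `E(t)` on the interval `[xL, xR]`. -/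
def energy (g H xL xR : ℝ) (h u : ℝ → ℝ → ℝ) (t : ℝ) : ℝ :=
  g / 2 * (∫ x in xL..xR, h x t ^ 2)
    + H / 2 * (∫ x in xL..xR, u x t ^ 2)
    + H ^ 3 / 6 * (∫ x in xL..xR, pdX u x t ^ 2)

/-- The boundary term `BT(h, u)(x, t)`. -/
def BT (g H U : ℝ) (h u : ℝ → ℝ → ℝ) (x t : ℝ) : ℝ :=
  -(g * H) * h x t * u x t - g * U / 2 * h x t ^ 2 - H * U / 2 * u x t ^ 2
    - H ^ 3 * U / 6 * pdX u x t ^ 2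
    + H ^ 3 * U / 3 * (u x t * pdX (pdX u) x t)
    + H ^ 3 / 3 * (u x t * pdT (pdX u) x t)

/-- Characteristic variable `w₄` for the case `U = 0`, with `C = 2√2·H²`. -/
def w4zero (g H : ℝ) (h u : ℝ → ℝ → ℝ) (x t : ℝ) : ℝ :=
  1 / (2 * Real.sqrt 2 * H ^ 2) *
    (2 * H ^ 2 * pdT (pdX u) x t - 6 * g * h x t - 2 * H ^ 2 * u x t)

/-- Characteristic variable `w₅` for the case `U = 0`, with `C = 2√2·H²`. -/
def w5zero (g H : ℝ) (h u : ℝ → ℝ → ℝ) (x t : ℝ) : ℝ :=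
  1 / (2 * Real.sqrt 2 * H ^ 2) *
    (2 * H ^ 2 * pdT (pdX u) x t - 6 * g * h x t + 2 * H ^ 2 * u x t)

theorem hasDerivAt_pdX {f : ℝ → ℝ → ℝ} (hf : ContDiff ℝ 1 (fun p : ℝ × ℝ => f p.1 p.2))
    (x t : ℝ) : HasDerivAt (fun ξ => f ξ t) (pdX f x t) x := by
  have hd : Differentiable ℝ (fun ξ : ℝ => f ξ t) :=
    (hf.differentiable one_ne_zero).comp (differentiable_id.prodMk (differentiable_const t))
  exact (hd x).hasDerivAt

theorem hasDerivAt_pdT {f : ℝ → ℝ → ℝ} (hf : ContDiff ℝ 1 (fun p : ℝ × ℝ => f p.1 p.2))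
    (x t : ℝ) : HasDerivAt (fun τ => f x τ) (pdT f x t) t := by
  have hd : Differentiable ℝ (fun τ : ℝ => f x τ) :=
    (hf.differentiable one_ne_zero).comp ((differentiable_const x).prodMk differentiable_id)
  exact (hd t).hasDerivAt

theorem contDiff_pdX {f : ℝ → ℝ → ℝ} {m n : WithTop ℕ∞}
    (hf : ContDiff ℝ n (fun p : ℝ × ℝ => f p.1 p.2)) (hmn : m + 1 ≤ n) :
    ContDiff ℝ m (fun p : ℝ × ℝ => pdX f p.1 p.2) := by
  have hd := (hf.of_le (le_add_self.trans hmn)).differentiable one_ne_zero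
  have key : (fun p : ℝ × ℝ => pdX f p.1 p.2)
      = fun p => fderiv ℝ (fun p : ℝ × ℝ => f p.1 p.2) p (1, 0) := by
    funext p
    exact ((hd p).hasFDerivAt.comp_hasDerivAt (f := fun ξ => (ξ, p.2)) p.1
      ((hasDerivAt_id p.1).prodMk (hasDerivAt_const p.1 p.2))).deriv
  rw [key]
  exact (hf.fderiv_right hmn).clm_apply contDiff_const

theorem contDiff_pdT {f : ℝ → ℝ → ℝ} {m n : WithTop ℕ∞}
    (hf : ContDiff ℝ n (fun p : ℝ × ℝ => f p.1 p.2)) (hmn : m + 1 ≤ n) :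
    ContDiff ℝ m (fun p : ℝ × ℝ => pdT f p.1 p.2) := by
  have hd := (hf.of_le (le_add_self.trans hmn)).differentiable one_ne_zero
  have key : (fun p : ℝ × ℝ => pdT f p.1 p.2)
      = fun p => fderiv ℝ (fun p : ℝ × ℝ => f p.1 p.2) p (0, 1) := by
    funext p
    exact ((hd p).hasFDerivAt.comp_hasDerivAt (f := fun τ => (p.1, τ)) p.2
      ((hasDerivAt_const p.2 p.1).prodMk (hasDerivAt_id p.2))).deriv
  rw [key]
  exact (hf.fderiv_right hmn).clm_apply contDiff_const

/-- Differentiation under the integral sign for a `C¹` integrand on a compact interval. -/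
theorem hasDerivAt_integral_pdT {f : ℝ → ℝ → ℝ}
    (hf : ContDiff ℝ 1 (fun p : ℝ × ℝ => f p.1 p.2)) (a b t : ℝ) :
    HasDerivAt (fun τ => ∫ x in a..b, f x τ) (∫ x in a..b, pdT f x t) t := by
  have hslice : ∀ τ : ℝ, Continuous fun x => f x τ := fun τ =>
    hf.continuous.comp (continuous_id.prodMk continuous_const)
  have hcT : Continuous fun p : ℝ × ℝ => pdT f p.1 p.2 :=
    (contDiff_pdT (m := 0) hf (by simp)).continuous
  obtain ⟨M, hM⟩ := (isCompact_uIcc.prod (isCompact_Icc (a := t - 1) (b := t + 1))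
    : IsCompact (uIcc a b ×ˢ Icc (t - 1) (t + 1))).exists_bound_of_continuousOn hcT.continuousOn
  refine (intervalIntegral.hasDerivAt_integral_of_dominated_loc_of_deriv_le
    (F := fun τ x => f x τ) (F' := fun τ x => pdT f x τ)
    (bound := fun _ => M) (Icc_mem_nhds (by linarith : t - 1 < t) (by linarith : t < t + 1))
    (Filter.Eventually.of_forall fun τ => (hslice τ).aestronglyMeasurable)
    ((hslice t).intervalIntegrable a b)
    (hcT.comp (continuous_id.prodMk continuous_const)).aestronglyMeasurable
    (Filter.Eventually.of_forall fun x hx τ hτ => hM (x, τ) ⟨uIoc_subset_uIcc hx, hτ⟩)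
    intervalIntegrable_const
    (Filter.Eventually.of_forall fun x _ τ _ => hasDerivAt_pdT hf x τ)).2

/-- The integrand of the energy. -/
def energyDensity (g H : ℝ) (h u : ℝ → ℝ → ℝ) (x t : ℝ) : ℝ :=
  g / 2 * h x t ^ 2 + H / 2 * u x t ^ 2 + H ^ 3 / 6 * pdX u x t ^ 2

section EnergyRate

variable {g H xL xR : ℝ} {h u : ℝ → ℝ → ℝ}

theorem contDiff_energyDensity (hh : ContDiff ℝ 1 (fun p : ℝ × ℝ => h p.1 p.2))
    (hu : ContDiff ℝ 2 (fun p : ℝ × ℝ => u p.1 p.2)) :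
    ContDiff ℝ 1 (fun p : ℝ × ℝ => energyDensity g H h u p.1 p.2) := by
  have hu1 : ContDiff ℝ 1 (fun p : ℝ × ℝ => u p.1 p.2) := hu.of_le (by norm_num)
  have hux : ContDiff ℝ 1 (fun p : ℝ × ℝ => pdX u p.1 p.2) := contDiff_pdX hu (by norm_num)
  exact ((contDiff_const.mul (hh.pow 2)).add (contDiff_const.mul (hu1.pow 2))).add
    (contDiff_const.mul (hux.pow 2))

theorem energy_eq_integral_energyDensity (hh : ContDiff ℝ 1 (fun p : ℝ × ℝ => h p.1 p.2))
    (hu : ContDiff ℝ 2 (fun p : ℝ × ℝ => u p.1 p.2)) (t : ℝ) :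
    energy g H xL xR h u t = ∫ x in xL..xR, energyDensity g H h u x t := by
  have hs : Continuous fun x : ℝ => (x, t) := continuous_id.prodMk continuous_const
  have c1 : Continuous fun x => h x t := hh.continuous.comp hs
  have c2 : Continuous fun x => u x t := hu.continuous.comp hs
  have c3 : Continuous fun x => pdX u x t :=
    (contDiff_pdX (m := 1) hu (by norm_num)).continuous.comp hs
  have i1 : IntervalIntegrable (fun x => g / 2 * h x t ^ 2) volume xL xR :=
    (continuous_const.mul (c1.pow 2)).intervalIntegrable _ _
  have i2 : IntervalIntegrable (fun x => H / 2 * u x t ^ 2) volume xL xR :=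
    (continuous_const.mul (c2.pow 2)).intervalIntegrable _ _
  have i3 : IntervalIntegrable (fun x => H ^ 3 / 6 * pdX u x t ^ 2) volume xL xR :=
    (continuous_const.mul (c3.pow 2)).intervalIntegrable _ _
  unfold energy energyDensity
  rw [intervalIntegral.integral_add (i1.add i2) i3, intervalIntegral.integral_add i1 i2]
  simp only [intervalIntegral.integral_const_mul]

theorem pdT_energyDensity (hh : ContDiff ℝ 1 (fun p : ℝ × ℝ => h p.1 p.2))
    (hu : ContDiff ℝ 2 (fun p : ℝ × ℝ => u p.1 p.2)) (x t : ℝ) :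
    pdT (energyDensity g H h u) x t = g * h x t * pdT h x t + H * u x t * pdT u x t
      + H ^ 3 / 3 * (pdX u x t * pdT (pdX u) x t) := by
  have d1 := hasDerivAt_pdT hh x t
  have d2 := hasDerivAt_pdT (hu.of_le (by norm_num)) x t
  have d3 := hasDerivAt_pdT (contDiff_pdX (m := 1) hu (by norm_num)) x t
  have d := (((d1.pow 2).const_mul (g / 2)).add ((d2.pow 2).const_mul (H / 2))).add
    ((d3.pow 2).const_mul (H ^ 3 / 6))
  refine d.deriv.trans ?_
  ring

theorem hasDerivAt_BT_zero (hh : ContDiff ℝ 1 (fun p : ℝ × ℝ => h p.1 p.2))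
    (hu : ContDiff ℝ 3 (fun p : ℝ × ℝ => u p.1 p.2)) (x t : ℝ) :
    HasDerivAt (fun ξ => BT g H 0 h u ξ t)
      (-(g * H) * (pdX h x t * u x t + h x t * pdX u x t)
        + H ^ 3 / 3 * (pdX u x t * pdT (pdX u) x t + u x t * pdX (pdT (pdX u)) x t)) x := by
  have hux : ContDiff ℝ 2 (fun p : ℝ × ℝ => pdX u p.1 p.2) := contDiff_pdX hu (by norm_num)
  have d1 := hasDerivAt_pdX hh x t
  have d2 := hasDerivAt_pdX (hu.of_le (by norm_num)) x t
  have d3 := hasDerivAt_pdX (contDiff_pdT (m := 1) hux (by norm_num)) x t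
  have d := ((d1.mul d2).const_mul (-(g * H))).add ((d2.mul d3).const_mul (H ^ 3 / 3))
  refine d.congr_of_eventuallyEq (Filter.Eventually.of_forall fun ξ => ?_)
  simp only [BT, Pi.add_apply, Pi.mul_apply]
  ring

/-- For solutions with `U = 0` the energy density is conserved up to the flux `BT`. -/
theorem SolvesSerre.pdT_energyDensity_eq (hsol : SolvesSerre g H 0 xL xR h u) {x t : ℝ}
    (hx : x ∈ Icc xL xR) (ht : 0 ≤ t) :
    pdT (energyDensity g H h u) x t
      = -(g * H) * (pdX h x t * u x t + h x t * pdX u x t)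
        + H ^ 3 / 3 * (pdX u x t * pdT (pdX u) x t + u x t * pdX (pdT (pdX u)) x t) := by
  obtain ⟨hh, hu, mass, mom⟩ := hsol
  have hh1 : ContDiff ℝ 1 (fun p : ℝ × ℝ => h p.1 p.2) := hh.of_le (by norm_num)
  have hux : ContDiff ℝ 2 (fun p : ℝ × ℝ => pdX u p.1 p.2) := contDiff_pdX hu (by norm_num)
  have d1 := hasDerivAt_pdX hh1 x t
  have d3 := hasDerivAt_pdX (contDiff_pdT (m := 1) hux (by norm_num)) x t
  have e1 : pdX (fun ξ τ => H * u ξ τ + 0 * h ξ τ) x t = H * pdX u x t := by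
    simp [pdX]
  have e2 : pdX (fun ξ τ => g * h ξ τ + 0 * u ξ τ - H ^ 2 * 0 / 3 * pdX (pdX u) ξ τ
      - H ^ 2 / 3 * pdT (pdX u) ξ τ) x t
      = g * pdX h x t - H ^ 2 / 3 * pdX (pdT (pdX u)) x t := by
    have d := (d1.const_mul g).sub (d3.const_mul (H ^ 2 / 3))
    refine (d.congr_of_eventuallyEq (Filter.Eventually.of_forall fun ξ => ?_)).deriv
    simp only [Pi.sub_apply]
    ring
  have m1 := mass x hx t ht
  have m2 := mom x hx t ht
  rw [e1] at m1
  rw [e2] at m2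
  rw [pdT_energyDensity hh1 (hu.of_le (by norm_num))]
  linear_combination g * h x t * m1 + H * u x t * m2

theorem SolvesSerre.hasDerivAt_energy (hsol : SolvesSerre g H 0 xL xR h u) (hx : xL ≤ xR)
    {t : ℝ} (ht : 0 ≤ t) :
    HasDerivAt (energy g H xL xR h u) (BT g H 0 h u xR t - BT g H 0 h u xL t) t := by
  have hh : ContDiff ℝ 1 (fun p : ℝ × ℝ => h p.1 p.2) := hsol.1.of_le (by norm_num)
  have hu : ContDiff ℝ 2 (fun p : ℝ × ℝ => u p.1 p.2) := hsol.2.1.of_le (by norm_num)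
  have hE : ContDiff ℝ 1 (fun p : ℝ × ℝ => energyDensity g H h u p.1 p.2) :=
    contDiff_energyDensity hh hu
  have hflux : ∀ x ∈ uIcc xL xR,
      HasDerivAt (fun ξ => BT g H 0 h u ξ t) (pdT (energyDensity g H h u) x t) x := by
    intro x hx'
    rw [uIcc_of_le hx] at hx'
    rw [hsol.pdT_energyDensity_eq hx' ht]
    exact hasDerivAt_BT_zero hh hsol.2.1 x t
  have hcont : Continuous fun x => pdT (energyDensity g H h u) x t :=
    (contDiff_pdT (m := 0) hE (by simp)).continuous.comp
      (continuous_id.prodMk continuous_const)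
  rw [← intervalIntegral.integral_eq_sub_of_hasDerivAt hflux (hcont.intervalIntegrable _ _),
    funext (energy_eq_integral_energyDensity (g := g) (H := H) (xL := xL) (xR := xR) hh hu)]
  exact hasDerivAt_integral_pdT hE xL xR t

theorem BT_zero_eq (hH : H ≠ 0) (x t : ℝ) :
    BT g H 0 h u x t = H ^ 3 / 6 * (w5zero g H h u x t ^ 2 - w4zero g H h u x t ^ 2) := by
  have h2 : Real.sqrt 2 ^ 2 = 2 := Real.sq_sqrt (by norm_num)
  have h0 : Real.sqrt 2 ≠ 0 := by positivity
  simp only [BT, w4zero, w5zero]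
  field_simp
  rw [h2]
  ring

end EnergyRate

/-- Theorem 3.5: well-posedness of the IBVP for `U = 0`; the energy is bounded
by the energy of the initial data. -/
theorem energy_bound_ibvp_U_zero (g H U xL xR : ℝ) (hg : 0 < g) (hH : 0 < H)
    (hx : xL < xR) (hU : U = 0) (h u : ℝ → ℝ → ℝ)
    (hsol : SolvesSerre g H U xL xR h u) (α β : ℝ)
    (hα₁ : -1 ≤ α) (hα₂ : α ≤ 1) (hβ₁ : -1 ≤ β) (hβ₂ : β ≤ 1)
    (hbcL : ∀ t : ℝ, 0 ≤ t → w4zero g H h u xL t = α * w5zero g H h u xL t)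
    (hbcR : ∀ t : ℝ, 0 ≤ t → w5zero g H h u xR t = β * w4zero g H h u xR t) :
    ∀ t : ℝ, 0 ≤ t → energy g H xL xR h u t ≤ energy g H xL xR h u 0 := by
  subst hU
  have hder : ∀ t : ℝ, 0 ≤ t → HasDerivAt (energy g H xL xR h u)
      (BT g H 0 h u xR t - BT g H 0 h u xL t) t := fun t ht => hsol.hasDerivAt_energy hx.le ht
  have hsq : ∀ c w : ℝ, -1 ≤ c → c ≤ 1 → (c * w) ^ 2 ≤ w ^ 2 := fun c w h₁ h₂ => by
    rw [sq_le_sq, abs_mul]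
    exact mul_le_of_le_one_left (abs_nonneg w) (abs_le.mpr ⟨h₁, h₂⟩)
  have hrate : ∀ t : ℝ, 0 ≤ t → BT g H 0 h u xR t - BT g H 0 h u xL t ≤ 0 := by
    intro t ht
    have hc : 0 ≤ H ^ 3 / 6 := by positivity
    rw [BT_zero_eq hH.ne', BT_zero_eq hH.ne', hbcL t ht, hbcR t ht, ← mul_sub]
    refine mul_nonpos_of_nonneg_of_nonpos hc ?_
    linarith [hsq α (w5zero g H h u xL t) hα₁ hα₂, hsq β (w4zero g H h u xR t) hβ₁ hβ₂]
  have hanti : AntitoneOn (energy g H xL xR h u) (Ici 0) := by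
    refine antitoneOn_of_deriv_nonpos (convex_Ici 0)
      (fun t ht => (hder t ht).continuousAt.continuousWithinAt) (fun t ht => ?_) fun t ht => ?_
    · exact (hder t (interior_subset ht)).differentiableAt.differentiableWithinAt
    · rw [(hder t (interior_subset ht)).deriv]
      exact hrate t (interior_subset ht)
  exact fun t ht => hanti self_mem_Ici ht ht
end
end

section
/- Let g, H > 0 and U ≥ 0. Let h, u : [0, ∞) → ℝⁿ be differentiable and satisfy the single-element scheme with right-boundary SAT penalties: h'(t) = −D(H u + U h) + H·M⁻¹e_R e_Rᵀ u, and u'(t) = −D(g h + U u − (H²U/3)D²u − (H²/3)D u'(t)) + (H²/3)M⁻¹Dᵀe_R e_Rᵀ u'(t) − (H²/3)M⁻¹e_R e_Rᵀ M⁻¹ e_R e_Rᵀ u'(t) − (H²U/3)M⁻¹(Dᵀ)² e_R e_Rᵀ u. Assume the contributions from the left boundary vanish for all t ≥ 0: h₁(t) = 0, u₁(t) = 0 and (D u(t))₁ = 0. Define D̃ = D − M⁻¹e_R e_Rᵀ and the discrete energy E(t) = (g/2)·h(t)ᵀM h(t) + (H/2)·u(t)ᵀM u(t) + (H³/6)·(D̃u(t))ᵀM(D̃u(t)).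 Then the discrete energy is bounded by that of the initial data: E(t) ≤ E(0) for all t ≥ 0. -/
open Matrix

noncomputable section

/-- The SBP boundary matrix `B = diag(-1, 0, …, 0, 1)` in dimension `n + 2`. -/
def Bbnd (n : ℕ) : Matrix (Fin (n + 2)) (Fin (n + 2)) ℝ :=
  Matrix.diagonal (fun i => if i = 0 then (-1 : ℝ) else if i = Fin.last (n + 1) then 1 else 0)

/-- The first coordinate vector `e_L = (1, 0, …, 0)ᵀ`. -/
def eVL (n : ℕ) : Fin (n + 2) → ℝ := fun i => if i = 0 then 1 else 0

/-- The last coordinate vector `e_R = (0, …, 0, 1)ᵀ`. -/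
def eVR (n : ℕ) : Fin (n + 2) → ℝ := fun i => if i = Fin.last (n + 1) then 1 else 0

theorem hasDerivAt_mulVec {m k : ℕ} (A : Matrix (Fin m) (Fin k) ℝ) {x : ℝ → Fin k → ℝ}
    {x' : Fin k → ℝ} {t : ℝ} (hx : HasDerivAt x x' t) :
    HasDerivAt (fun s => A *ᵥ x s) (A *ᵥ x') t :=
  (Matrix.mulVecLin A).toContinuousLinearMap.hasFDerivAt.comp_hasDerivAt t hx

theorem hasDerivAt_dotProduct_diagonal_mulVec {k : ℕ} (d : Fin k → ℝ) {x : ℝ → Fin k → ℝ}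
    {x' : Fin k → ℝ} {t : ℝ} (hx : HasDerivAt x x' t) :
    HasDerivAt (fun s => x s ⬝ᵥ (diagonal d *ᵥ x s)) (2 * (x t ⬝ᵥ (diagonal d *ᵥ x'))) t := by
  simp only [dotProduct, mulVec_diagonal, Finset.mul_sum]
  refine HasDerivAt.fun_sum fun i _ => ?_
  have hi := hasDerivAt_pi.mp hx i
  exact (hi.mul (hi.const_mul (d i))).congr_deriv (by ring)

theorem dotProduct_diagonal_mulVec_comm {k : ℕ} (d x y : Fin k → ℝ) :
    x ⬝ᵥ (diagonal d *ᵥ y) = y ⬝ᵥ (diagonal d *ᵥ x) := by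
  simp only [dotProduct, mulVec_diagonal]
  exact Finset.sum_congr rfl fun i _ => by ring

theorem dotProduct_eVR (n : ℕ) (x : Fin (n + 2) → ℝ) : x ⬝ᵥ eVR n = x (Fin.last (n + 1)) := by
  simp [dotProduct, eVR]

theorem vecMulVec_eVR_mulVec (n : ℕ) (x : Fin (n + 2) → ℝ) :
    vecMulVec (eVR n) (eVR n) *ᵥ x = x (Fin.last (n + 1)) • eVR n := by
  rw [vecMulVec_mulVec, dotProduct_comm, dotProduct_eVR]
  simp

theorem dotProduct_Bbnd_mulVec (n : ℕ) (x y : Fin (n + 2) → ℝ) :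
    x ⬝ᵥ (Bbnd n *ᵥ y) = x (Fin.last (n + 1)) * y (Fin.last (n + 1)) - x 0 * y 0 := by
  have hi (i : Fin (n + 2)) :
      x i * ((if i = 0 then (-1 : ℝ) else if i = Fin.last (n + 1) then 1 else 0) * y i)
        = (if i = Fin.last (n + 1) then x i * y i else 0) - if i = 0 then x i * y i else 0 := by
    by_cases h : i = 0
    · subst h
      simp [Fin.ext_iff]
    · simp [h]
  simp only [dotProduct, Bbnd, mulVec_diagonal, hi, Finset.sum_sub_distrib]
  simp

/-- Summation by parts. -/
theorem dotProduct_mulVec_add_of_sbp {n : ℕ} {M D : Matrix (Fin (n + 2)) (Fin (n + 2)) ℝ}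
    (hSBP : M * D + Dᵀ * M = Bbnd n) (x y : Fin (n + 2) → ℝ) :
    x ⬝ᵥ (M *ᵥ (D *ᵥ y)) + (D *ᵥ x) ⬝ᵥ (M *ᵥ y)
      = x (Fin.last (n + 1)) * y (Fin.last (n + 1)) - x 0 * y 0 := by
  rw [← dotProduct_Bbnd_mulVec, ← hSBP, add_mulVec, dotProduct_add, mulVec_mulVec,
    ← mulVec_mulVec y Dᵀ M, dotProduct_mulVec x Dᵀ, vecMul_transpose]

/-- Theorem 4.9: the single-element scheme with right-boundary SAT penalties has
nonincreasing discrete energy (left boundary contributions being assumed to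
vanish). -/
theorem right_boundary_sat_energy_bound (n : ℕ)
    (M D : Matrix (Fin (n + 2)) (Fin (n + 2)) ℝ)
    (d : Fin (n + 2) → ℝ) (hM : M = Matrix.diagonal d) (hd : ∀ i, 0 < d i)
    (hSBP : M * D + Dᵀ * M = Bbnd n)
    (g H U : ℝ) (hg : 0 < g) (hH : 0 < H) (hU : 0 ≤ U)
    (hv uv : ℝ → Fin (n + 2) → ℝ)
    (hhv : Differentiable ℝ hv) (huv : Differentiable ℝ uv)
    (hschemeh : ∀ t : ℝ, 0 ≤ t →
      deriv hv t = -(D *ᵥ (H • uv t + U • hv t))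
        + H • ((M⁻¹ * vecMulVec (eVR n) (eVR n)) *ᵥ uv t))
    (hschemeu : ∀ t : ℝ, 0 ≤ t →
      deriv uv t = -(D *ᵥ (g • hv t + U • uv t
            - (H ^ 2 * U / 3) • ((D ^ 2) *ᵥ uv t)
            - (H ^ 2 / 3) • (D *ᵥ deriv uv t)))
        + (H ^ 2 / 3) • ((M⁻¹ * Dᵀ * vecMulVec (eVR n) (eVR n)) *ᵥ deriv uv t)
        - (H ^ 2 / 3) • ((M⁻¹ * vecMulVec (eVR n) (eVR n) * M⁻¹
            * vecMulVec (eVR n) (eVR n)) *ᵥ deriv uv t)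
        - (H ^ 2 * U / 3) • ((M⁻¹ * (Dᵀ) ^ 2 * vecMulVec (eVR n) (eVR n)) *ᵥ uv t))
    (hbd_h : ∀ t : ℝ, 0 ≤ t → hv t 0 = 0)
    (hbd_u : ∀ t : ℝ, 0 ≤ t → uv t 0 = 0)
    (hbd_Du : ∀ t : ℝ, 0 ≤ t → (D *ᵥ uv t) 0 = 0)
    (E : ℝ → ℝ)
    (hE : ∀ t : ℝ, E t = g / 2 * (hv t ⬝ᵥ (M *ᵥ hv t)) + H / 2 * (uv t ⬝ᵥ (M *ᵥ uv t))
      + H ^ 3 / 6 * (((D - M⁻¹ * vecMulVec (eVR n) (eVR n)) *ᵥ uv t)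
          ⬝ᵥ (M *ᵥ ((D - M⁻¹ * vecMulVec (eVR n) (eVR n)) *ᵥ uv t)))) :
    ∀ t : ℝ, 0 ≤ t → E t ≤ E 0 := by
  set L := Fin.last (n + 1)
  have hMu : IsUnit M.det := by
    rw [hM, det_diagonal]
    exact (Finset.prod_pos fun i _ => hd i).ne'.isUnit
  have hMM (w : Fin (n + 2) → ℝ) : M *ᵥ (M⁻¹ *ᵥ w) = w := by
    rw [mulVec_mulVec, mul_nonsing_inv _ hMu, one_mulVec]
  have hsymm (x y : Fin (n + 2) → ℝ) : x ⬝ᵥ (M *ᵥ y) = y ⬝ᵥ (M *ᵥ x) := by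
    rw [hM]; exact dotProduct_diagonal_mulVec_comm d x y
  have hsbp := dotProduct_mulVec_add_of_sbp hSBP
  have hDT (x y : Fin (n + 2) → ℝ) : x ⬝ᵥ (Dᵀ *ᵥ y) = (D *ᵥ x) ⬝ᵥ y := by
    rw [dotProduct_mulVec, vecMul_transpose]
  set A := D - M⁻¹ * vecMulVec (eVR n) (eVR n) with hA
  have hderiv (t : ℝ) : HasDerivAt E (g * (hv t ⬝ᵥ (M *ᵥ deriv hv t))
      + H * (uv t ⬝ᵥ (M *ᵥ deriv uv t))
      + H ^ 3 / 3 * ((A *ᵥ uv t) ⬝ᵥ (M *ᵥ (A *ᵥ deriv uv t)))) t := by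
    rw [funext hE, hM]
    have h1 := hasDerivAt_dotProduct_diagonal_mulVec d (hhv t).hasDerivAt
    have h2 := hasDerivAt_dotProduct_diagonal_mulVec d (huv t).hasDerivAt
    have h3 := hasDerivAt_dotProduct_diagonal_mulVec d (hasDerivAt_mulVec A (huv t).hasDerivAt)
    exact (((h1.const_mul (g / 2)).add (h2.const_mul (H / 2))).add
      (h3.const_mul (H ^ 3 / 6))).congr_deriv (by ring)
  have hrate (t : ℝ) (ht : 0 ≤ t) : g * (hv t ⬝ᵥ (M *ᵥ deriv hv t))
      + H * (uv t ⬝ᵥ (M *ᵥ deriv uv t))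
      + H ^ 3 / 3 * ((A *ᵥ uv t) ⬝ᵥ (M *ᵥ (A *ᵥ deriv uv t)))
      = -(U / 2 * (g * hv t L ^ 2 + H * uv t L ^ 2 + H ^ 3 / 3 * (D *ᵥ uv t) L ^ 2)) := by
    have eh := congrArg (fun w => hv t ⬝ᵥ (M *ᵥ w)) (hschemeh t ht)
    have eu := congrArg (fun w => uv t ⬝ᵥ (M *ᵥ w)) (hschemeu t ht)
    have h0 := hbd_h t ht
    have u0 := hbd_u t ht
    have Du0 := hbd_Du t ht
    generalize deriv hv t = h' at *
    generalize deriv uv t = u' at *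
    generalize hv t = h at *
    generalize uv t = u at *
    have eA : (A *ᵥ u) ⬝ᵥ (M *ᵥ (A *ᵥ u')) = (D *ᵥ u) ⬝ᵥ (M *ᵥ (D *ᵥ u'))
        - u L * (D *ᵥ u') L - u' L * (D *ᵥ u) L + u L * u' L * (M⁻¹ *ᵥ eVR n) L := by
      simp only [hA, sub_mulVec, ← mulVec_mulVec, vecMulVec_eVR_mulVec, mulVec_smul, mulVec_sub,
        hMM, dotProduct_sub, dotProduct_smul, sub_dotProduct, smul_dotProduct, dotProduct_eVR,
        smul_eq_mul, hsymm (M⁻¹ *ᵥ eVR n)]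
      ring
    simp only [pow_two, mulVec_add, mulVec_sub, mulVec_neg, mulVec_smul, ← mulVec_mulVec,
      vecMulVec_eVR_mulVec, hMM, dotProduct_add, dotProduct_sub, dotProduct_neg, dotProduct_smul,
      smul_eq_mul, hDT, dotProduct_eVR] at eh eu
    have s1 := hsbp h h
    have s2 := hsbp u u
    have s3 := hsbp u h
    have s4 := hsbp u (D *ᵥ u')
    have s5 := hsbp u (D *ᵥ (D *ᵥ u))
    have s6 := hsbp (D *ᵥ u) (D *ᵥ u)
    rw [hsymm (D *ᵥ h) h] at s1
    rw [hsymm (D *ᵥ u) u] at s2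
    rw [hsymm (D *ᵥ u) h] at s3
    rw [hsymm (D *ᵥ (D *ᵥ u)) (D *ᵥ u)] at s6
    simp only [h0, u0, Du0, mul_zero, zero_mul, sub_zero] at s1 s2 s3 s4 s5 s6
    rw [eh, eu, eA]
    linear_combination (-(g * U / 2)) * s1 - H * U / 2 * s2 - g * H * s3 + H ^ 3 / 3 * s4
      + H ^ 3 * U / 3 * s5 - H ^ 3 * U / 6 * s6
  have hanti : AntitoneOn E (Set.Ici 0) := by
    refine antitoneOn_of_deriv_nonpos (convex_Ici 0)
      (fun t _ => (hderiv t).continuousAt.continuousWithinAt)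
      (fun t _ => (hderiv t).differentiableAt.differentiableWithinAt) fun t ht => ?_
    rw [(hderiv t).deriv, hrate t (interior_subset ht), neg_nonpos]
    positivity
  exact fun t ht => hanti Set.self_mem_Ici ht ht
end
end
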